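/- If M ∈ 𝓜(6,7,C) with |C| = 19, then there do not exist two distinct colours α, β of frequency 2 arranged as (M)_{i₁,j₁} = α = (M)_{i₂,j₂} and (M)_{i₂,j₁} = β = (M)_{i₃,j₂} for distinct rows i₁,i₂,i₃ and distinct columns j₁,j₂ (type (2¹1², 2²)). -/

import Mathlib

/-- `M ∈ 𝓜(p,q,C)`: all lines of `M` have pairwise distinct entries and every
pair of distinct colours of `C` is row-based or column-based in `M`. -/
def MemM {p q : ℕ} {C : Type*} (M : Fin p → Fin q → C) : Prop :=
  (∀ i, Function.Injective (M i)) ∧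
  (∀ j, Function.Injective fun i => M i j) ∧
  ∀ c₁ c₂ : C, c₁ ≠ c₂ →
    (∃ i j₁ j₂, M i j₁ = c₁ ∧ M i j₂ = c₂) ∨
    (∃ i₁ i₂ j, M i₁ j = c₁ ∧ M i₂ j = c₂)

/-- The frequency of a colour: its number of occurrences as an entry of `M`. -/
noncomputable def freq {C : Type*} (M : Fin 6 → Fin 7 → C) (γ : C) : ℕ :=
  Nat.card {x : Fin 6 × Fin 7 // M x.1 x.2 = γ}

/-- home rows of the 13 `K`-colours: 0-4 are the colours of the middle row (value unused),
5 and 6 are the two single ones, 7-12 the six remaining column colours. -/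
def hm : Fin 13 → Fin 5 := ![0, 0, 0, 0, 0, 1, 0, 2, 2, 3, 3, 4, 4]

/-- the column of the `n`-th colour in the middle row, as an index of `Fin 13` -/
def pI (n : Fin 5) : Fin 13 := ⟨n.1, by omega⟩

/-- Some middle-row colour is in the outer row 0. -/
lemma abs_case1 (r c : Fin 13 → Fin 5)
    (hinj : ∀ k l, r k = r l → c k = c l → k = l)
    (h0 : ∀ k l, r k = 0 → r l = 0 → k = l)
    (h1 : ∀ k l, r k = 1 → r l = 1 → k = l)
    (hh5 : r 5 ≠ 1)
    (hv : ∀ (n : Fin 5) (k : Fin 13), 5 ≤ k.1 → k ≠ 6 →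
      r (pI n) = hm k ∨ r (pI n) = r k ∨ n = c k ∨ c (pI n) = c k)
    (m : Fin 5) (hm0 : r (pI m) = 0) : False := by
  have hpne : ∀ k : Fin 13, 5 ≤ k.1 → k ≠ pI m := by
    intro k hk h; rw [h] at hk; simp [pI] at hk; omega
  have hk0 : ∀ k : Fin 13, k ≠ pI m → r k ≠ 0 := fun k hk h => hk (h0 _ _ h hm0)
  -- the colours lie in two columns
  have hcol : ∀ k : Fin 13, 5 ≤ k.1 → k ≠ 6 → c k = m ∨ c k = c (pI m) := by
    intro k hk hk6
    rcases hv m k hk hk6 with h | h | h | h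
    · exfalso; rw [hm0] at h
      revert h hk hk6; revert k; decide
    · exact absurd (h.symm.trans hm0) (hk0 k (hpne k hk))
    · exact Or.inl h.symm
    · exact Or.inr h.symm
  -- target cells
  set f : Fin 13 → Fin 5 × Fin 5 := fun k => if r k = 1 then (1, 0) else (r k, c k) with hf
  have hfinj : ∀ k l, f k = f l → k = l := by
    intro k l h
    simp only [hf] at h
    split_ifs at h with a b b
    · exact h1 _ _ a b
    · simp only [Prod.mk.injEq] at h; exact absurd h.1.symm b
    · simp only [Prod.mk.injEq] at h; exact absurd h.1 a
    · simp only [Prod.mk.injEq] at h; exact hinj _ _ h.1 h.2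
  have hrow : ∀ x : Fin 5, x ≠ 0 → x ≠ 1 → x = 2 ∨ x = 3 ∨ x = 4 := by decide
  have hP : ∀ n, n ≠ m → r (pI n) ≠ 1 ∧ c (pI n) ≠ m ∧ c (pI n) ≠ c (pI m) := by
    intro n hn
    by_contra hcon
    have hnm : pI n ≠ pI m := by
      intro h; apply hn; simpa [pI, Fin.ext_iff] using h
    let T : Finset (Fin 5 × Fin 5) := insert (1, 0) ({2, 3, 4} ×ˢ {m, c (pI m)})
    let S : Finset (Fin 13) := insert (pI n) {5, 7, 8, 9, 10, 11, 12}
    have hS : S.card = 8 := by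
      have : ∀ n : Fin 5, (insert (pI n) ({5, 7, 8, 9, 10, 11, 12} : Finset (Fin 13))).card = 8 := by
        decide
      exact this n
    have hT : T.card ≤ 7 := by
      refine (Finset.card_insert_le _ _).trans ?_
      rw [Finset.card_product]
      have : ({m, c (pI m)} : Finset (Fin 5)).card ≤ 2 := Finset.card_le_two
      have h3 : ({2, 3, 4} : Finset (Fin 5)).card = 3 := by decide
      rw [h3]; omega
    have hmaps : ∀ k ∈ S, f k ∈ T := by
      intro k hk
      have hk' : k ≠ pI m ∧ (r k = 1 ∨ c k = m ∨ c k = c (pI m)) := by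
        rcases Finset.mem_insert.1 hk with rfl | hk
        · refine ⟨hnm, ?_⟩; tauto
        · have : 5 ≤ k.1 ∧ k ≠ 6 := by
            clear * - hk; revert k; decide
          exact ⟨hpne k this.1, Or.inr (hcol k this.1 this.2)⟩
      simp only [hf, T]
      split_ifs with a
      · simp
      · have hb := hrow _ (hk0 k hk'.1) a
        have hc := hk'.2.resolve_left a
        simp only [Finset.mem_insert, Finset.mem_product, Finset.mem_singleton]
        right; exact ⟨hb, hc⟩
    obtain ⟨k, -, l, -, hkl, hfe⟩ := Finset.exists_ne_map_eq_of_card_lt_of_maps_to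
      (by omega : T.card < S.card) hmaps
    exact hkl (hfinj _ _ hfe)
  -- the row of the colour 5
  have h5row : ∀ n, n ≠ m → n ≠ c (pI m) → r (pI n) = r 5 := by
    intro n hn hn'
    obtain ⟨a, b, d⟩ := hP n hn
    have hc5 := hcol 5 (by decide) (by decide)
    rcases hv n 5 (by decide) (by decide) with h | h | h | h
    · exact absurd h a
    · exact h
    · rcases hc5 with e | e <;> rw [e] at h <;> contradiction
    · rcases hc5 with e | e <;> rw [e] at h <;> contradiction
  obtain ⟨n, hn, hn'⟩ : ∃ n, n ≠ m ∧ n ≠ c (pI m) := by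
    have : ∀ x y : Fin 5, ∃ n, n ≠ x ∧ n ≠ y := by decide
    exact this _ _
  have hr5 := h5row n hn hn'
  obtain ⟨a, b, d⟩ := hP n hn
  let S : Finset (Fin 13) := ({7, 8, 9, 10, 11, 12} : Finset (Fin 13)).filter (fun k => hm k ≠ r 5)
  have hS : 4 ≤ S.card := by
    have : ∀ x : Fin 5,
      4 ≤ (({7, 8, 9, 10, 11, 12} : Finset (Fin 13)).filter (fun k => hm k ≠ x)).card := by decide
    exact this _
  let T : Finset (Fin 5 × Fin 5) := {(1, 0), (r 5, m), (r 5, c (pI m))}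
  have hT : T.card ≤ 3 := Finset.card_le_three
  have hmaps : ∀ k ∈ S, f k ∈ T := by
    intro k hk
    obtain ⟨hk, hkr⟩ := Finset.mem_filter.1 hk
    have h5 : 5 ≤ k.1 ∧ k ≠ 6 := by
      clear * - hk; revert k; decide
    have hc := hcol k h5.1 h5.2
    simp only [hf, T]
    split_ifs with e
    · simp
    · have : r k = r 5 := by
        rcases hv n k h5.1 h5.2 with h | h | h | h
        · exact absurd (h.symm.trans hr5) hkr
        · exact h.symm.trans hr5
        · rcases hc with e | e <;> rw [e] at h <;> contradiction
        · rcases hc with e | e <;> rw [e] at h <;> contradiction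
      rw [this]
      rcases hc with e | e <;> rw [e] <;> simp
  obtain ⟨k, -, l, -, hkl, hfe⟩ := Finset.exists_ne_map_eq_of_card_lt_of_maps_to
    (by omega : T.card < S.card) hmaps
  exact hkl (hfinj _ _ hfe)

/-- number of middle-row colours whose second copy is in row `w` -/
def pcnt (r : Fin 13 → Fin 5) (w : Fin 5) : ℕ := (Finset.univ.filter fun n : Fin 5 => r (pI n) = w).card

/-- number (0 or 1) of middle-row colours whose second copy is in cell `w, b` -/
def ocnt (r c : Fin 13 → Fin 5) (w b : Fin 5) : ℕ :=
  (Finset.univ.filter fun n : Fin 5 => r (pI n) = w ∧ c (pI n) = b).card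

lemma pI_inj {m n : Fin 5} (h : pI m = pI n) : m = n := by
  simpa [pI, Fin.ext_iff] using h

/-- No middle-row colour is in the outer rows. -/
lemma abs_case3 (r c : Fin 13 → Fin 5)
    (hinj : ∀ k l, r k = r l → c k = c l → k = l)
    (h0 : ∀ k l, r k = 0 → r l = 0 → k = l)
    (h1 : ∀ k l, r k = 1 → r l = 1 → k = l)
    (hh : ∀ k : Fin 13, 5 ≤ k.1 → r k ≠ hm k)
    (hv : ∀ (n : Fin 5) (k : Fin 13), 5 ≤ k.1 →
      r (pI n) = hm k ∨ r (pI n) = r k ∨ n = c k ∨ c (pI n) = c k)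
    (hX : ∀ n, r (pI n) ≠ 0 ∧ r (pI n) ≠ 1) : False := by
  have hrow : ∀ x : Fin 5, x ≠ 0 → x ≠ 1 → x = 2 ∨ x = 3 ∨ x = 4 := by decide
  have hXr : ∀ n, r (pI n) = 2 ∨ r (pI n) = 3 ∨ r (pI n) = 4 := fun n => hrow _ (hX n).1 (hX n).2
  have ho1 : ∀ w b, ocnt r c w b ≤ 1 := by
    intro w b
    refine Finset.card_le_one.2 ?_
    intro x hx y hy
    simp only [Finset.mem_filter, Finset.mem_univ, true_and] at hx hy
    exact pI_inj (hinj _ _ (hx.1.trans hy.1.symm) (hx.2.trans hy.2.symm))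
  -- occupancy versus row count
  have hop : ∀ w b, ocnt r c w b ≤ pcnt r w := by
    intro w b
    apply Finset.card_le_card
    intro n hn
    simp only [Finset.mem_filter, Finset.mem_univ, true_and] at hn ⊢
    exact hn.1
  have hop2 : ∀ w b d, b ≠ d → ocnt r c w b + ocnt r c w d ≤ pcnt r w := by
    intro w b d hbd
    unfold ocnt pcnt
    rw [← Finset.card_union_of_disjoint]
    · apply Finset.card_le_card
      intro n hn
      simp only [Finset.mem_union, Finset.mem_filter, Finset.mem_univ, true_and] at hn ⊢
      tauto
    · rw [Finset.disjoint_left]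
      intro n hn hn'
      simp only [Finset.mem_filter, Finset.mem_univ, true_and] at hn hn'
      exact hbd (hn.2.symm.trans hn'.2)
  have htot : pcnt r 2 + pcnt r 3 + pcnt r 4 = 5 := by
    have e : (Finset.univ : Finset (Fin 5)) =
        (Finset.univ.filter fun n : Fin 5 => r (pI n) = 2) ∪
        ((Finset.univ.filter fun n : Fin 5 => r (pI n) = 3) ∪
        (Finset.univ.filter fun n : Fin 5 => r (pI n) = 4)) := by
      ext n
      have := hXr n
      simp [this]
    have e2 := congrArg Finset.card e
    rw [Finset.card_union_of_disjoint, Finset.card_union_of_disjoint] at e2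
    · simp only [Finset.card_univ, Fintype.card_fin] at e2
      unfold pcnt; omega
    · rw [Finset.disjoint_left]
      intro n hn hn'
      simp only [Finset.mem_filter, Finset.mem_univ, true_and] at hn hn'
      rw [hn] at hn'; revert hn'; decide
    · rw [Finset.disjoint_left]
      intro n hn hn'
      simp only [Finset.mem_union, Finset.mem_filter, Finset.mem_univ, true_and] at hn hn'
      rw [hn] at hn'; revert hn'; decide
  -- counting bound for the two single colours
  have hbd : ∀ k : Fin 13, k = 5 ∨ k = 6 →
      5 ≤ (if r k = 2 then pcnt r 2 else ocnt r c 2 (c k)) +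
        ((if r k = 3 then pcnt r 3 else ocnt r c 3 (c k)) +
        (if r k = 4 then pcnt r 4 else ocnt r c 4 (c k))) + 1 := by
    intro k hk
    have hk5 : 5 ≤ k.1 := by rcases hk with rfl | rfl <;> decide
    have hkh : ∀ n, r (pI n) ≠ hm k := by
      intro n; rcases hk with rfl | rfl
      · exact (hX n).2
      · exact (hX n).1
    have hc : ∀ w, (Finset.univ.filter fun n : Fin 5 => r (pI n) = w ∧ (r k = w ∨ c (pI n) = c k)).card
        = if r k = w then pcnt r w else ocnt r c w (c k) := by
      intro w
      split_ifs with h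
      · simp [pcnt, h]
      · simp [ocnt, h]
    rw [← hc, ← hc, ← hc]
    have e : (Finset.univ : Finset (Fin 5)) ⊆
        ((Finset.univ.filter fun n : Fin 5 => r (pI n) = 2 ∧ (r k = 2 ∨ c (pI n) = c k)) ∪
        ((Finset.univ.filter fun n : Fin 5 => r (pI n) = 3 ∧ (r k = 3 ∨ c (pI n) = c k)) ∪
        (Finset.univ.filter fun n : Fin 5 => r (pI n) = 4 ∧ (r k = 4 ∨ c (pI n) = c k)))) ∪ {c k} := by
      intro n _
      have h1 := hXr n
      have h2 := hkh n
      have h3 := hv n k hk5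
      simp only [Finset.mem_union, Finset.mem_filter, Finset.mem_univ, true_and,
        Finset.mem_singleton]
      rcases h3 with h | h | h | h
      · exact absurd h h2
      · rw [← h]; tauto
      · right; exact h
      · tauto
    have e2 := Finset.card_le_card e
    simp only [Finset.card_univ, Fintype.card_fin] at e2
    refine e2.trans ((Finset.card_union_le _ _).trans ?_)
    rw [Finset.card_singleton]
    refine Nat.add_le_add_right ((Finset.card_union_le _ _).trans ?_) 1
    exact Nat.add_le_add_left (Finset.card_union_le _ _) _
  -- the single colours are inside
  have hin : ∀ k : Fin 13, k = 5 ∨ k = 6 → r k = 2 ∨ r k = 3 ∨ r k = 4 := by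
    intro k hk
    have := hbd k hk
    by_contra hcon
    push Not at hcon
    rw [if_neg hcon.1, if_neg hcon.2.1, if_neg hcon.2.2] at this
    have := ho1 2 (c k); have := ho1 3 (c k); have := ho1 4 (c k)
    omega
  -- rows have at most two
  have hle2 : ∀ w : Fin 5, w = 2 ∨ w = 3 ∨ w = 4 → pcnt r w ≤ 2 := by
    intro w hw
    by_contra hcon
    have hq : ∀ k : Fin 13, 7 ≤ k.1 → hm k ≠ w → r k = w ∨ r k = 0 ∨ r k = 1 := by
      intro k hk hkw
      by_contra hne
      push Not at hne
      apply hcon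
      have hs : (Finset.univ.filter fun n : Fin 5 => r (pI n) = w) ⊆
          (Finset.univ.filter fun n : Fin 5 => r (pI n) = w ∧ c (pI n) = c k) ∪ {c k} := by
        intro n hn
        simp only [Finset.mem_union, Finset.mem_filter, Finset.mem_univ, true_and,
          Finset.mem_singleton] at hn ⊢
        rcases hv n k (by omega) with h | h | h | h
        · exact absurd (h.symm.trans hn) hkw
        · exact absurd (h.symm.trans hn) hne.1
        · right; exact h
        · left; exact ⟨hn, h⟩
      have h2 := (Finset.card_le_card hs).trans (Finset.card_union_le _ _)
      have h3 := ho1 w (c k)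
      rw [Finset.card_singleton] at h2
      unfold ocnt at h3
      unfold pcnt
      omega
    -- no single colour in row w
    have h5w : r 5 ≠ w := by
      intro h5w
      let S : Finset (Fin 13) := insert 5 (({7, 8, 9, 10, 11, 12} : Finset (Fin 13)).filter
        (fun k => hm k ≠ w)) ∪ (Finset.univ.filter fun n : Fin 5 => r (pI n) = w).image pI
      let f : Fin 13 → Fin 5 × Fin 5 := fun k =>
        if r k = 0 then (0, 0) else if r k = 1 then (1, 0) else (r k, c k)
      have hfinj : ∀ k l, f k = f l → k = l := by
        intro k l h
        have g0 := h0 k l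
        have g1 := h1 k l
        have g2 := hinj k l
        simp only [f] at h
        split_ifs at h <;> simp only [Prod.mk.injEq] at h <;> grind
      let T : Finset (Fin 5 × Fin 5) := insert (0, 0) (insert (1, 0) ({w} ×ˢ Finset.univ))
      have hT : T.card ≤ 7 := by
        refine (Finset.card_insert_le _ _).trans ?_
        refine Nat.succ_le_succ ((Finset.card_insert_le _ _).trans ?_)
        rw [Finset.card_product]; simp
      have hS : 8 ≤ S.card := by
        have hd : Disjoint (insert 5 (({7, 8, 9, 10, 11, 12} : Finset (Fin 13)).filter
            (fun k => hm k ≠ w)))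
            ((Finset.univ.filter fun n : Fin 5 => r (pI n) = w).image pI) := by
          rw [Finset.disjoint_left]
          intro k hk hk'
          obtain ⟨n, -, rfl⟩ := Finset.mem_image.1 hk'
          have : ∀ n : Fin 5, pI n ∉ ({5, 7, 8, 9, 10, 11, 12} : Finset (Fin 13)) := by decide
          apply this n
          rcases Finset.mem_insert.1 hk with h | h
          · rw [h]; decide
          · exact Finset.mem_insert_of_mem (Finset.mem_filter.1 h).1
        have h5 : (insert 5 (({7, 8, 9, 10, 11, 12} : Finset (Fin 13)).filter
            (fun k => hm k ≠ w))).card ≥ 5 := by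
          have : ∀ w : Fin 5, (insert 5 (({7, 8, 9, 10, 11, 12} : Finset (Fin 13)).filter
            (fun k => hm k ≠ w))).card ≥ 5 := by decide
          exact this w
        have h6 : ((Finset.univ.filter fun n : Fin 5 => r (pI n) = w).image pI).card = pcnt r w :=
          Finset.card_image_of_injective _ (fun _ _ h => pI_inj h)
        have : S.card = _ := Finset.card_union_of_disjoint hd
        omega
      have hmaps : ∀ k ∈ S, f k ∈ T := by
        intro k hk
        have : r k = w ∨ r k = 0 ∨ r k = 1 := by
          rcases Finset.mem_union.1 hk with hk | hk
          · rcases Finset.mem_insert.1 hk with rfl | hk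
            · exact Or.inl h5w
            · obtain ⟨hk, hkw⟩ := Finset.mem_filter.1 hk
              refine hq k ?_ hkw
              clear * - hk; revert k; decide
          · obtain ⟨n, hn, rfl⟩ := Finset.mem_image.1 hk
            exact Or.inl (Finset.mem_filter.1 hn).2
        simp only [f, T]
        split_ifs with a b
        · simp
        · simp
        · have : r k = w := by tauto
          simp [this]
      obtain ⟨k, -, l, -, hkl, hfe⟩ := Finset.exists_ne_map_eq_of_card_lt_of_maps_to
        (by omega : T.card < S.card) hmaps
      exact hkl (hfinj _ _ hfe)
    have hb := hbd 5 (Or.inl rfl)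
    have ha := hin 5 (Or.inl rfl)
    have o2 := ho1 2 (c 5)
    have o3 := ho1 3 (c 5)
    have o4 := ho1 4 (c 5)
    have p2 := hop 2 (c 5)
    have p3 := hop 3 (c 5)
    have p4 := hop 4 (c 5)
    rcases ha with h | h | h <;> rw [h] at hb h5w <;> simp at hb <;>
      rcases hw with rfl | rfl | rfl <;> first | omega | exact h5w rfl
  have l2 := hle2 2 (by simp)
  have l3 := hle2 3 (by simp)
  have l4 := hle2 4 (by simp)
  have hb5 := hbd 5 (Or.inl rfl)
  have hb6 := hbd 6 (Or.inr rfl)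
  have a5 := hin 5 (Or.inl rfl)
  have a6 := hin 6 (Or.inr rfl)
  have o2 := ho1 2 (c 5)
  have o3 := ho1 3 (c 5)
  have o4 := ho1 4 (c 5)
  have o2' := ho1 2 (c 6)
  have o3' := ho1 3 (c 6)
  have o4' := ho1 4 (c 6)
  -- occupied cells are not the cells of single colours
  have hz : ∀ k : Fin 13, 5 ≤ k.1 → ocnt r c (r k) (c k) = 0 := by
    intro k hk
    unfold ocnt
    rw [Finset.card_eq_zero, Finset.filter_eq_empty_iff]
    intro n _ h
    have := hinj _ _ h.1 h.2
    rw [← this] at hk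
    simp [pI] at hk; omega
  have z5 := hz 5 (by decide)
  have z6 := hz 6 (by decide)
  by_cases hcc : c 5 = c 6
  · have hr : r 5 ≠ r 6 := fun h => absurd (hinj 5 6 h hcc) (by decide)
    rw [hcc] at hb5 z5
    rcases a5 with h | h | h <;> rcases a6 with h' | h' | h' <;>
      rw [h] at hb5 z5 hr <;> rw [h'] at hb6 z6 hr <;> simp at hb5 hb6 hr <;> omega
  · have q2 := hop2 2 _ _ hcc
    have q3 := hop2 3 _ _ hcc
    have q4 := hop2 4 _ _ hcc
    rcases a5 with h | h | h <;> rcases a6 with h' | h' | h' <;>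
      rw [h] at hb5 z5 <;> rw [h'] at hb6 z6 <;> simp at hb5 hb6 <;> omega

lemma abs_main (r c : Fin 13 → Fin 5)
    (hinj : ∀ k l, r k = r l → c k = c l → k = l)
    (h0 : ∀ k l, r k = 0 → r l = 0 → k = l)
    (h1 : ∀ k l, r k = 1 → r l = 1 → k = l)
    (hh : ∀ k : Fin 13, 5 ≤ k.1 → r k ≠ hm k)
    (hv : ∀ (n : Fin 5) (k : Fin 13), 5 ≤ k.1 →
      r (pI n) = hm k ∨ r (pI n) = r k ∨ n = c k ∨ c (pI n) = c k) : False := by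
  by_cases hA : ∃ m, r (pI m) = 0
  · obtain ⟨m, hm0⟩ := hA
    exact abs_case1 r c hinj h0 h1 (hh 5 (by decide)) (fun n k hk _ => hv n k hk) m hm0
  by_cases hB : ∃ m, r (pI m) = 1
  · obtain ⟨m, hm1⟩ := hB
    -- apply the first case after exchanging rows 0, 1 and colours 5, 6
    let s : Fin 5 → Fin 5 := Equiv.swap 0 1
    let t : Fin 13 → Fin 13 := Equiv.swap 5 6
    have hs : ∀ x y, s x = s y → x = y := fun x y h => (Equiv.swap 0 1).injective h
    have ht : ∀ x y, t x = t y → x = y := fun x y h => (Equiv.swap 5 6).injective h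
    have htp : ∀ n, t (pI n) = pI n := by decide
    have hs0 : ∀ x, s x = 0 → x = 1 := by decide
    have hs1 : ∀ x, s x = 1 → x = 0 := by decide
    refine abs_case1 (fun k => s (r (t k))) (fun k => c (t k)) ?_ ?_ ?_ ?_ ?_ m ?_
    · intro k l a b; exact ht _ _ (hinj _ _ (hs _ _ a) b)
    · intro k l a b; exact ht _ _ (h1 _ _ (hs0 _ a) (hs0 _ b))
    · intro k l a b; exact ht _ _ (h0 _ _ (hs1 _ a) (hs1 _ b))
    · intro a; exact hh 6 (by decide) (hs1 _ a)
    · intro n k hk hk6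
      have e1 : 5 ≤ (t k).1 := by revert hk hk6; revert k; decide
      have e2 : s (hm (t k)) = hm k := by
        clear e1; revert hk hk6; revert k; decide
      simp only [htp]
      rcases hv n (t k) e1 with h | h | h | h
      · left; rw [h, e2]
      · right; left; rw [h]
      · right; right; left; exact h
      · right; right; right; exact h
    · show s (r (t (pI m))) = 0
      rw [htp, hm1]; decide
  · push Not at hA hB
    exact abs_case3 r c hinj h0 h1 hh hv (fun n => ⟨hA n, hB n⟩)

/-- the 13 cells seen by both colours -/
def kc : Fin 13 → Fin 6 × Fin 7 :=
  ![(1, 2), (1, 3), (1, 4), (1, 5), (1, 6), (2, 0), (0, 1), (3, 0), (3, 1), (4, 0), (4, 1),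
    (5, 0), (5, 1)]

/-- outer rows -/
def rI : Fin 5 → Fin 6 := ![0, 2, 3, 4, 5]

/-- outer columns -/
def cI : Fin 5 → Fin 7 := ![2, 3, 4, 5, 6]

lemma rI_inj {x y : Fin 5} (h : rI x = rI y) : x = y := by revert x y; decide

lemma cI_inj {x y : Fin 5} (h : cI x = cI y) : x = y := by revert x y; decide

lemma core {C : Type*} [Fintype C] (M : Fin 6 → Fin 7 → C)
    (hM : MemM M) (hC : Fintype.card C = 19) (α β : C) (hab : α ≠ β)
    (hα : freq M α = 2) (hβ : freq M β = 2)
    (h00 : M 0 0 = α) (h11 : M 1 1 = α) (h10 : M 1 0 = β) (h21 : M 2 1 = β) : False := by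
  classical
  obtain ⟨hMr, hMc, hMp⟩ := hM
  let F : C → Finset (Fin 6 × Fin 7) := fun c => Finset.univ.filter fun x => M x.1 x.2 = c
  have hF : ∀ c x, x ∈ F c ↔ M x.1 x.2 = c := by intro c x; simp [F]
  have hfr : ∀ c, freq M c = (F c).card := by
    intro c
    unfold freq
    rw [Nat.card_eq_fintype_card, Fintype.card_subtype]
  rw [hfr] at hα hβ
  have hsee : ∀ c d, c ≠ d → ∃ x y : Fin 6 × Fin 7, M x.1 x.2 = c ∧ M y.1 y.2 = d ∧
      (x.1 = y.1 ∨ x.2 = y.2) := by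
    intro c d h
    rcases hMp c d h with ⟨i, j, k, a, b⟩ | ⟨i, j, k, a, b⟩
    · exact ⟨(i, j), (i, k), a, b, Or.inl rfl⟩
    · exact ⟨(i, k), (j, k), a, b, Or.inr rfl⟩
  have hsum : ∑ c, (F c).card = 42 := by
    have := Finset.card_eq_sum_card_fiberwise (s := (Finset.univ : Finset (Fin 6 × Fin 7)))
      (t := (Finset.univ : Finset C)) (f := fun x => M x.1 x.2) (by intro x _; simp)
    rw [← this]; decide
  have hge2 : ∀ c, 2 ≤ (F c).card := by
    intro c
    by_contra hcon
    have hle : (F c).card ≤ 1 := by omega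
    rw [Finset.card_le_one] at hle
    have hone : 1 < Fintype.card C := by omega
    haveI : Nontrivial C := Fintype.one_lt_card_iff_nontrivial.1 hone
    obtain ⟨d, hd⟩ := exists_ne c
    obtain ⟨x0, -, hx0, -, -⟩ := hsee c d hd.symm
    have hsub : Finset.univ.erase c ⊆ (Finset.univ.filter fun y : Fin 6 × Fin 7 =>
        y ≠ x0 ∧ (x0.1 = y.1 ∨ x0.2 = y.2)).image fun y => M y.1 y.2 := by
      intro d hd
      have hdc := Finset.ne_of_mem_erase hd
      obtain ⟨x, y, hx, hy, hxy⟩ := hsee c d hdc.symm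
      have : x = x0 := hle x ((hF _ _).2 hx) x0 ((hF _ _).2 hx0)
      subst this
      refine Finset.mem_image.2 ⟨y, ?_, hy⟩
      simp only [Finset.mem_filter, Finset.mem_univ, true_and]
      refine ⟨?_, hxy⟩
      rintro rfl
      exact hdc (hy.symm.trans hx)
    have h1 := (Finset.card_le_card hsub).trans Finset.card_image_le
    rw [Finset.card_erase_of_mem (Finset.mem_univ _), Finset.card_univ, hC] at h1
    have h2 : ∀ x0 : Fin 6 × Fin 7, (Finset.univ.filter fun y : Fin 6 × Fin 7 =>
        y ≠ x0 ∧ (x0.1 = y.1 ∨ x0.2 = y.2)).card ≤ 11 := by decide +kernel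
    have := h2 x0
    omega
  have htwo : ∀ (c : C) (x y : Fin 6 × Fin 7), (F c).card = 2 → M x.1 x.2 = c → M y.1 y.2 = c → x ≠ y →
      ∀ z : Fin 6 × Fin 7, M z.1 z.2 = c → z = x ∨ z = y := by
    intro c x y h2 hx hy hxy z hz
    have hs : ({x, y} : Finset (Fin 6 × Fin 7)) ⊆ F c := by
      intro w hw
      rcases Finset.mem_insert.1 hw with rfl | hw
      · exact (hF _ _).2 hx
      · rw [Finset.mem_singleton.1 hw]; exact (hF _ _).2 hy
    have he := Finset.eq_of_subset_of_card_le hs (by rw [h2, Finset.card_pair hxy])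
    have : z ∈ ({x, y} : Finset (Fin 6 × Fin 7)) := by rw [he]; exact (hF _ _).2 hz
    simpa using this
  have hαc := htwo α (0, 0) (1, 1) hα h00 h11 (by decide)
  have hβc := htwo β (1, 0) (2, 1) hβ h10 h21 (by decide)
  have hkcα : ∀ k, M (kc k).1 (kc k).2 ≠ α := by
    intro k h
    have h' := hαc _ h
    clear * - h'; revert k; decide
  have hkcβ : ∀ k, M (kc k).1 (kc k).2 ≠ β := by
    intro k h
    have h' := hβc _ h
    clear * - h'; revert k; decide
  let SK : Finset C := Finset.univ.image fun k => M (kc k).1 (kc k).2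
  let S1 : Finset C := Finset.univ.image fun j => M 0 (cI j)
  let S3 : Finset C := Finset.univ.image fun j => M 2 (cI j)
  let A : Finset C := Finset.univ.filter fun c => c ≠ α ∧ c ≠ β ∧ c ∉ SK
  have hSKm : ∀ k, M (kc k).1 (kc k).2 ∈ SK := fun k =>
    Finset.mem_image.2 ⟨k, Finset.mem_univ _, rfl⟩
  have hSKα : α ∉ SK := by
    intro h; obtain ⟨k, -, hk⟩ := Finset.mem_image.1 h; exact hkcα k hk
  have hSKβ : β ∉ SK := by
    intro h; obtain ⟨k, -, hk⟩ := Finset.mem_image.1 h; exact hkcβ k hk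
  have hSK13 : SK.card ≤ 13 := Finset.card_image_le.trans (by simp)
  have hS1c : S1.card ≤ 5 := Finset.card_image_le.trans (by simp)
  have hS3c : S3.card ≤ 5 := Finset.card_image_le.trans (by simp)
  have hAK : A.card + SK.card = 17 := by
    have h1 : Disjoint A SK := by
      rw [Finset.disjoint_left]; intro c hc; exact (Finset.mem_filter.1 hc).2.2.2
    have h2 : A ∪ SK = (Finset.univ.erase α).erase β := by
      ext c
      simp only [A, Finset.mem_union, Finset.mem_filter, Finset.mem_univ, true_and,
        Finset.mem_erase, and_true]
      constructor
      · rintro (h | h)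
        · exact ⟨h.2.1, h.1⟩
        · exact ⟨fun e => hSKβ (e ▸ h), fun e => hSKα (e ▸ h)⟩
      · intro h
        by_cases hc : c ∈ SK
        · exact Or.inr hc
        · exact Or.inl ⟨h.2, h.1, hc⟩
    rw [← Finset.card_union_of_disjoint h1, h2, Finset.card_erase_of_mem, Finset.card_erase_of_mem,
      Finset.card_univ, hC]
    · exact Finset.mem_univ _
    · exact Finset.mem_erase.2 ⟨hab.symm, Finset.mem_univ _⟩
  have hA1 : ∀ a ∈ A, ∃ j, M 0 (cI j) = a := by
    intro a ha
    obtain ⟨ha1, ha2, ha3⟩ := (Finset.mem_filter.1 ha).2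
    obtain ⟨x, y, hx, hy, hxy⟩ := hsee α a ha1.symm
    have hx' := hαc x hx
    have key : ∀ x y : Fin 6 × Fin 7, (x = (0, 0) ∨ x = (1, 1)) → (x.1 = y.1 ∨ x.2 = y.2) →
        y = (0, 0) ∨ y = (1, 1) ∨ y = (1, 0) ∨ y = (2, 1) ∨ (∃ k, y = kc k) ∨
        ∃ j, y = (0, cI j) := by decide +kernel
    rcases key x y hx' hxy with rfl | rfl | rfl | rfl | ⟨k, rfl⟩ | ⟨j, rfl⟩
    · exact absurd (hy.symm.trans h00) ha1
    · exact absurd (hy.symm.trans h11) ha1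
    · exact absurd (hy.symm.trans h10) ha2
    · exact absurd (hy.symm.trans h21) ha2
    · exact absurd (hy ▸ hSKm k) ha3
    · exact ⟨j, hy⟩
  have hA3 : ∀ a ∈ A, ∃ j, M 2 (cI j) = a := by
    intro a ha
    obtain ⟨ha1, ha2, ha3⟩ := (Finset.mem_filter.1 ha).2
    obtain ⟨x, y, hx, hy, hxy⟩ := hsee β a ha2.symm
    have hx' := hβc x hx
    have key : ∀ x y : Fin 6 × Fin 7, (x = (1, 0) ∨ x = (2, 1)) → (x.1 = y.1 ∨ x.2 = y.2) →
        y = (0, 0) ∨ y = (1, 1) ∨ y = (1, 0) ∨ y = (2, 1) ∨ (∃ k, y = kc k) ∨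
        ∃ j, y = (2, cI j) := by decide +kernel
    rcases key x y hx' hxy with rfl | rfl | rfl | rfl | ⟨k, rfl⟩ | ⟨j, rfl⟩
    · exact absurd (hy.symm.trans h00) ha1
    · exact absurd (hy.symm.trans h11) ha1
    · exact absurd (hy.symm.trans h10) ha2
    · exact absurd (hy.symm.trans h21) ha2
    · exact absurd (hy ▸ hSKm k) ha3
    · exact ⟨j, hy⟩
  have hAS1 : A ⊆ S1 := by
    intro a ha; obtain ⟨j, hj⟩ := hA1 a ha; exact Finset.mem_image.2 ⟨j, Finset.mem_univ _, hj⟩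
  have hAS3 : A ⊆ S3 := by
    intro a ha; obtain ⟨j, hj⟩ := hA3 a ha; exact Finset.mem_image.2 ⟨j, Finset.mem_univ _, hj⟩
  have hA4 : 4 ≤ A.card := by omega
  -- colours of `A` have frequency at least 3
  have hAfr : ∀ a ∈ A, 3 ≤ (F a).card := by
    intro a ha
    by_contra hcon
    have h2 : (F a).card = 2 := by have := hge2 a; omega
    obtain ⟨j, hj⟩ := hA1 a ha
    obtain ⟨j', hj'⟩ := hA3 a ha
    have hac := htwo a (0, cI j) (2, cI j') h2 hj hj' (by simp)
    have ha3 := (Finset.mem_filter.1 ha).2.2.2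
    let W : Finset (Fin 6) := {1, 3, 4, 5}
    have hsub : SK ⊆ {M 0 1, M 2 0} ∪ ((S1 \ A) ∪ ((S3 \ A) ∪
        (W.image (fun w => M w (cI j)) ∪ W.image (fun w => M w (cI j'))))) := by
      intro c hc
      have hca : c ∉ A := fun h => (Finset.mem_filter.1 h).2.2.2 hc
      have hne : a ≠ c := by rintro rfl; exact hca ha
      obtain ⟨x, y, hx, hy, hxy⟩ := hsee a c hne
      have hx' := hac x hx
      have key : ∀ y : Fin 6 × Fin 7, ∀ j j' : Fin 5,
          (y.1 = 0 ∨ y.1 = 2 ∨ y.2 = cI j ∨ y.2 = cI j') →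
          y = (0, 0) ∨ y = (2, 1) ∨ y = (0, 1) ∨ y = (2, 0) ∨ (∃ i, y = (0, cI i)) ∨
          (∃ i, y = (2, cI i)) ∨ (∃ w ∈ ({1, 3, 4, 5} : Finset (Fin 6)), y = (w, cI j)) ∨
          ∃ w ∈ ({1, 3, 4, 5} : Finset (Fin 6)), y = (w, cI j') := by decide +kernel
      have hy' : y.1 = 0 ∨ y.1 = 2 ∨ y.2 = cI j ∨ y.2 = cI j' := by
        rcases hx' with rfl | rfl <;> rcases hxy with h | h <;> simp only at h <;> rw [← h] <;> simp
      simp only [Finset.mem_union, Finset.mem_sdiff, Finset.mem_insert, Finset.mem_singleton]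
      rcases key y j j' hy' with rfl | rfl | rfl | rfl | ⟨i, rfl⟩ | ⟨i, rfl⟩ | ⟨w, hw, rfl⟩ |
        ⟨w, hw, rfl⟩
      · exact absurd (hy.symm.trans h00 ▸ hc) hSKα
      · exact absurd (hy.symm.trans h21 ▸ hc) hSKβ
      · exact Or.inl (Or.inl hy.symm)
      · exact Or.inl (Or.inr hy.symm)
      · exact Or.inr (Or.inl ⟨Finset.mem_image.2 ⟨i, Finset.mem_univ _, hy⟩, hca⟩)
      · exact Or.inr (Or.inr (Or.inl ⟨Finset.mem_image.2 ⟨i, Finset.mem_univ _, hy⟩, hca⟩))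
      · exact Or.inr (Or.inr (Or.inr (Or.inl (Finset.mem_image.2 ⟨w, hw, hy⟩))))
      · exact Or.inr (Or.inr (Or.inr (Or.inr (Finset.mem_image.2 ⟨w, hw, hy⟩))))
    have e0 := Finset.card_le_card hsub
    have e1 := Finset.card_union_le ({M 0 1, M 2 0} : Finset C) ((S1 \ A) ∪ ((S3 \ A) ∪
        (W.image (fun w => M w (cI j)) ∪ W.image (fun w => M w (cI j')))))
    have e2 := Finset.card_union_le (S1 \ A) ((S3 \ A) ∪
        (W.image (fun w => M w (cI j)) ∪ W.image (fun w => M w (cI j'))))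
    have e3 := Finset.card_union_le (S3 \ A)
        (W.image (fun w => M w (cI j)) ∪ W.image (fun w => M w (cI j')))
    have e4 := Finset.card_union_le (W.image (fun w => M w (cI j)))
      (W.image (fun w => M w (cI j')))
    have e5 : (W.image (fun w => M w (cI j))).card ≤ 4 := Finset.card_image_le.trans (by decide)
    have e6 : (W.image (fun w => M w (cI j'))).card ≤ 4 := Finset.card_image_le.trans (by decide)
    have e7 : ({M 0 1, M 2 0} : Finset C).card ≤ 2 := Finset.card_le_two
    have e8 := Finset.card_sdiff_of_subset hAS1
    have e9 := Finset.card_sdiff_of_subset hAS3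
    have e10 := Finset.card_le_card hAS1
    omega
  -- excess counting
  have hexc : ∀ B : Finset C, (∀ b ∈ B, 3 ≤ (F b).card) → B.card ≤ 4 := by
    intro B hB
    have h1 : ∑ c, (2 + if c ∈ B then 1 else 0) ≤ ∑ c, (F c).card := by
      apply Finset.sum_le_sum
      intro c _
      split_ifs with h
      · exact hB c h
      · exact hge2 c
    rw [hsum, Finset.sum_add_distrib] at h1
    simp [hC] at h1
    omega
  have hAc : A.card = 4 := le_antisymm (hexc A hAfr) hA4
  have hSKc : SK.card = 13 := by omega
  have hkinj : ∀ k l, M (kc k).1 (kc k).2 = M (kc l).1 (kc l).2 → k = l := by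
    have : Set.InjOn (fun k => M (kc k).1 (kc k).2) ((Finset.univ : Finset (Fin 13)) : Set (Fin 13)) :=
      Finset.card_image_iff.1 (by simpa using hSKc)
    intro k l h
    exact this (by simp) (by simp) h
  have hkA : ∀ k, M (kc k).1 (kc k).2 ∉ A := fun k h => (Finset.mem_filter.1 h).2.2.2 (hSKm k)
  have hk2 : ∀ k, (F (M (kc k).1 (kc k).2)).card = 2 := by
    intro k
    by_contra hcon
    have h3 : 3 ≤ (F (M (kc k).1 (kc k).2)).card := by
      have := hge2 (M (kc k).1 (kc k).2); omega
    have := hexc (insert (M (kc k).1 (kc k).2) A) (by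
      intro b hb
      rcases Finset.mem_insert.1 hb with rfl | hb
      · exact h3
      · exact hAfr b hb)
    rw [Finset.card_insert_of_notMem (hkA k)] at this
    omega
  have hpos : ∀ k, ∃ p : Fin 5 × Fin 5, M (rI p.1) (cI p.2) = M (kc k).1 (kc k).2 := by
    intro k
    obtain ⟨y, hy, hyk⟩ := Finset.exists_mem_ne (by rw [hk2 k]; norm_num) (kc k)
    rw [hF] at hy
    have key : ∀ y : Fin 6 × Fin 7, y = (0, 0) ∨ y = (1, 1) ∨ y = (1, 0) ∨ y = (2, 1) ∨
      (∃ k, y = kc k) ∨ ∃ p : Fin 5 × Fin 5, y = (rI p.1, cI p.2) := by decide +kernel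
    rcases key y with rfl | rfl | rfl | rfl | ⟨l, rfl⟩ | ⟨p, rfl⟩
    · exact absurd (hy.symm.trans h00) (hkcα k)
    · exact absurd (hy.symm.trans h11) (hkcα k)
    · exact absurd (hy.symm.trans h10) (hkcβ k)
    · exact absurd (hy.symm.trans h21) (hkcβ k)
    · exact absurd (congrArg kc (hkinj _ _ hy)) hyk
    · exact ⟨p, hy⟩
  choose p hp using hpos
  have hkp : ∀ k, kc k ≠ (rI (p k).1, cI (p k).2) := by
    have : ∀ k, ∀ q : Fin 5 × Fin 5, kc k ≠ (rI q.1, cI q.2) := by decide +kernel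
    intro k; exact this k _
  have hocc : ∀ (k : Fin 13) (z : Fin 6 × Fin 7), M z.1 z.2 = M (kc k).1 (kc k).2 → z = kc k ∨ z = (rI (p k).1, cI (p k).2) :=
    fun k => htwo _ (kc k) (rI (p k).1, cI (p k).2) (hk2 k) rfl (hp k) (hkp k)
  have huniq : ∀ (S : Finset C) (i : Fin 6), S = Finset.univ.image (fun j => M i (cI j)) →
      A ⊆ S → S.card ≤ 5 → ∀ k l, rI (p k).1 = i → rI (p l).1 = i → k = l := by
    intro S i hS hAS hSc k l hk hl
    by_contra hkl
    have hmem : ∀ k, rI (p k).1 = i → M (kc k).1 (kc k).2 ∈ S := by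
      intro k hk
      rw [hS, ← hp k, hk]
      exact Finset.mem_image.2 ⟨_, Finset.mem_univ _, rfl⟩
    have hsub : insert (M (kc k).1 (kc k).2) (insert (M (kc l).1 (kc l).2) A) ⊆ S := by
      intro c hc
      rcases Finset.mem_insert.1 hc with rfl | hc
      · exact hmem k hk
      rcases Finset.mem_insert.1 hc with rfl | hc
      · exact hmem l hl
      exact hAS hc
    have := Finset.card_le_card hsub
    rw [Finset.card_insert_of_notMem, Finset.card_insert_of_notMem (hkA l)] at this
    · omega
    · intro h
      rcases Finset.mem_insert.1 h with h | h
      · exact hkl (hkinj _ _ h)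
      · exact hkA k h
  refine abs_main (fun k => (p k).1) (fun k => (p k).2) ?_ ?_ ?_ ?_ ?_
  · intro k l a b
    apply hkinj
    rw [← hp k, ← hp l]
    rw [a, b]
  · intro k l a b
    exact huniq S1 0 rfl hAS1 hS1c k l (by rw [a]; rfl) (by rw [b]; rfl)
  · intro k l a b
    exact huniq S3 2 rfl hAS3 hS3c k l (by rw [a]; rfl) (by rw [b]; rfl)
  · intro k hk a
    have e : (kc k).1 = rI (hm k) := by clear * - hk; revert k; decide
    have h := hp k
    rw [a, ← e] at h
    have := hMr _ h
    exact hkp k (by rw [a, ← e, this])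
  · intro n k hk
    have hne : pI n ≠ k := by rintro rfl; simp [pI] at hk; omega
    obtain ⟨x, y, hx, hy, hxy⟩ := hsee (M (kc (pI n)).1 (kc (pI n)).2) (M (kc k).1 (kc k).2)
      (fun h => hne (hkinj _ _ h))
    have hx' := hocc _ x hx
    have hy' := hocc _ y hy
    have e : (kc k).1 = rI (hm k) := by clear * - hk; revert k; decide
    have e2 : ∀ j, (kc k).2 ≠ cI j := by clear * - hk; revert k; decide
    have e3 : (kc (pI n)).1 = 1 := by clear * -; revert n; decide
    have e4 : (kc (pI n)).2 = cI n := by clear * -; revert n; decide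
    have e5 : ∀ i, (1 : Fin 6) ≠ rI i := by decide
    rcases hx' with rfl | rfl <;> rcases hy' with rfl | rfl <;> rcases hxy with h | h <;>
      try simp only at h
    · rw [e3, e] at h; exact absurd h (e5 _)
    · rw [e4] at h; exact absurd h.symm (e2 _)
    · rw [e3] at h; exact absurd h (e5 _)
    · rw [e4] at h; exact Or.inr (Or.inr (Or.inl (cI_inj h)))
    · rw [e] at h; exact Or.inl (rI_inj h)
    · exact absurd h.symm (e2 _)
    · exact Or.inr (Or.inl (rI_inj h))
    · exact Or.inr (Or.inr (Or.inr (cI_inj h)))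

lemma perm_pair {n : ℕ} (a b x y : Fin n) (hab : a ≠ b) (hxy : x ≠ y) :
    ∃ σ : Equiv.Perm (Fin n), σ a = x ∧ σ b = y := by
  refine ⟨(Equiv.swap a x).trans (Equiv.swap (Equiv.swap a x b) y), ?_, by simp⟩
  rw [Equiv.trans_apply, Equiv.swap_apply_left]
  refine Equiv.swap_apply_of_ne_of_ne ?_ hxy
  intro h
  apply hab
  apply (Equiv.swap a x).injective
  rw [Equiv.swap_apply_left]; exact h

lemma perm_triple {n : ℕ} (a b c x y z : Fin n) (hab : a ≠ b) (hac : a ≠ c) (hbc : b ≠ c)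
    (hxy : x ≠ y) (hxz : x ≠ z) (hyz : y ≠ z) :
    ∃ σ : Equiv.Perm (Fin n), σ a = x ∧ σ b = y ∧ σ c = z := by
  obtain ⟨σ, h1, h2⟩ := perm_pair a b x y hab hxy
  refine ⟨σ.trans (Equiv.swap (σ c) z), ?_, ?_, by simp⟩
  · rw [Equiv.trans_apply, h1]
    exact Equiv.swap_apply_of_ne_of_ne (by rw [← h1]; exact σ.injective.ne hac) hxz
  · rw [Equiv.trans_apply, h2]
    exact Equiv.swap_apply_of_ne_of_ne (by rw [← h2]; exact σ.injective.ne hbc) hyz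

theorem no_type_211_22 {C : Type*} [Fintype C] (M : Fin 6 → Fin 7 → C)
    (hM : MemM M) (hC : Fintype.card C = 19) :
    ¬ ∃ (α β : C) (i₁ i₂ i₃ : Fin 6) (j₁ j₂ : Fin 7),
        α ≠ β ∧ freq M α = 2 ∧ freq M β = 2 ∧
        i₁ ≠ i₂ ∧ i₁ ≠ i₃ ∧ i₂ ≠ i₃ ∧ j₁ ≠ j₂ ∧
        M i₁ j₁ = α ∧ M i₂ j₂ = α ∧ M i₂ j₁ = β ∧ M i₃ j₂ = β := by
  rintro ⟨α, β, i₁, i₂, i₃, j₁, j₂, hab, hα, hβ, h12, h13, h23, hj, m1, m2, m3, m4⟩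
  obtain ⟨σ, s0, s1, s2⟩ := perm_triple 0 1 2 i₁ i₂ i₃ (by decide) (by decide) (by decide) h12 h13 h23
  obtain ⟨τ, t0, t1⟩ := perm_pair 0 1 j₁ j₂ (by decide) hj
  have hfr : ∀ c, freq (fun i j => M (σ i) (τ j)) c = freq M c := by
    intro c
    unfold freq
    refine Nat.card_congr (Equiv.subtypeEquiv (Equiv.prodCongr σ τ) ?_)
    intro x; rfl
  refine core (fun i j => M (σ i) (τ j)) ⟨?_, ?_, ?_⟩ hC α β hab ((hfr _).trans hα)
    ((hfr _).trans hβ) ?_ ?_ ?_ ?_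
  · intro i a b h; exact τ.injective (hM.1 _ h)
  · intro j a b h; exact σ.injective (hM.2.1 _ h)
  · intro c d h
    rcases hM.2.2 c d h with ⟨i, j, k, a, b⟩ | ⟨i, j, k, a, b⟩
    · exact Or.inl ⟨σ.symm i, τ.symm j, τ.symm k, by simpa using a, by simpa using b⟩
    · exact Or.inr ⟨σ.symm i, σ.symm j, τ.symm k, by simpa using a, by simpa using b⟩
  · simpa [s0, t0] using m1
  · simpa [s1, t1] using m2
  · simpa [s1, t0] using m3
  · simpa [s2, t1] using m4
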